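/- arXiv:2510.01627 — 4 statements merged into one kernel-verified Lean document; each statement's English description precedes it below -/
import Mathlib

section
/- Let H be a real number with 1/2 < H < 1 and let a < b be real numbers. Then the iterated Lebesgue integral of the Riesz kernel over the square [a,b]^2 satisfies ∫_a^b ∫_a^b |x−y|^{2H−2} dy dx = (b−a)^{2H} / ((2H−1)·H). -/
open MeasureTheory

lemma intervalIntegrable_abs_rpow_of_nonneg {r c : ℝ} (hr : -1 < r) (hc : 0 ≤ c) :
    IntervalIntegrable (fun t : ℝ => |t| ^ r) volume 0 c := by
  refine (intervalIntegral.intervalIntegrable_rpow' hr).congr fun t ht => ?_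
  rw [Set.uIoc_of_le hc] at ht
  simp only [abs_of_pos ht.1]

lemma integral_abs_rpow_of_nonneg {r c : ℝ} (hr : -1 < r) (hc : 0 ≤ c) :
    ∫ t in (0 : ℝ)..c, |t| ^ r = c ^ (r + 1) / (r + 1) := by
  have h : ∫ t in (0 : ℝ)..c, |t| ^ r = ∫ t in (0 : ℝ)..c, t ^ r := by
    refine intervalIntegral.integral_congr fun t ht => ?_
    rw [Set.uIcc_of_le hc] at ht
    simp only [abs_of_nonneg ht.1]
  rw [h, integral_rpow (Or.inl hr), Real.zero_rpow (by linarith), sub_zero]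

lemma integral_abs_sub_rpow {r a b x : ℝ} (hr : -1 < r) (hx : x ∈ Set.Icc a b) :
    ∫ y in a..b, |x - y| ^ r = ((x - a) ^ (r + 1) + (b - x) ^ (r + 1)) / (r + 1) := by
  have hxa : 0 ≤ x - a := sub_nonneg.2 hx.1
  have hbx : 0 ≤ b - x := sub_nonneg.2 hx.2
  have hleft : ∫ y in a..x, |x - y| ^ r = (x - a) ^ (r + 1) / (r + 1) := by
    rw [intervalIntegral.integral_comp_sub_left (fun t => |t| ^ r), sub_self,
      integral_abs_rpow_of_nonneg hr hxa]
  have hright : ∫ y in x..b, |x - y| ^ r = (b - x) ^ (r + 1) / (r + 1) := by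
    simp_rw [abs_sub_comm x]
    rw [intervalIntegral.integral_comp_sub_right (fun t => |t| ^ r), sub_self,
      integral_abs_rpow_of_nonneg hr hbx]
  have ileft : IntervalIntegrable (fun y => |x - y| ^ r) volume a x := by
    simpa using ((intervalIntegrable_abs_rpow_of_nonneg hr hxa).comp_sub_left x).symm
  have iright : IntervalIntegrable (fun y => |x - y| ^ r) volume x b := by
    simp_rw [abs_sub_comm x]
    simpa using (intervalIntegrable_abs_rpow_of_nonneg hr hbx).comp_sub_right x
  rw [← intervalIntegral.integral_add_adjacent_intervals ileft iright, hleft, hright, add_div]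

/-- Exact value of the Riesz-kernel integral over a square `[a,b]²`. -/
theorem riesz_square_integral (H a b : ℝ) (hH₁ : 1/2 < H) (hH₂ : H < 1) (hab : a < b) :
    ∫ x in a..b, ∫ y in a..b, |x - y| ^ (2*H - 2) =
      (b - a) ^ (2*H) / ((2*H - 1) * H) := by
  have hinner : ∫ x in a..b, ∫ y in a..b, |x - y| ^ (2*H - 2) =
      ∫ x in a..b, ((x - a) ^ (2*H - 1) + (b - x) ^ (2*H - 1)) / (2*H - 1) := by
    refine intervalIntegral.integral_congr fun x hx => ?_
    rw [Set.uIcc_of_le hab.le] at hx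
    simp only [integral_abs_sub_rpow (r := 2*H - 2) (by linarith) hx,
      show 2*H - 2 + 1 = 2*H - 1 by ring]
  have hcont : Continuous fun t : ℝ => t ^ (2*H - 1) :=
    Real.continuous_rpow_const (by linarith)
  have hleft : Continuous fun x : ℝ => (x - a) ^ (2*H - 1) :=
    hcont.comp (continuous_id.sub continuous_const)
  have hright : Continuous fun x : ℝ => (b - x) ^ (2*H - 1) :=
    hcont.comp (continuous_const.sub continuous_id)
  have hpow : ∫ t in (0 : ℝ)..(b - a), t ^ (2*H - 1) = (b - a) ^ (2*H) / (2*H) := by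
    rw [integral_rpow (Or.inl (by linarith)), sub_add_cancel, Real.zero_rpow (by linarith),
      sub_zero]
  rw [hinner, intervalIntegral.integral_div, intervalIntegral.integral_add
    (hleft.intervalIntegrable a b) (hright.intervalIntegrable a b),
    intervalIntegral.integral_comp_sub_right (fun t => t ^ (2*H - 1)),
    intervalIntegral.integral_comp_sub_left (fun t => t ^ (2*H - 1)), sub_self, sub_self, hpow]
  have h₁ : 2*H - 1 ≠ 0 := by linarith
  have h₂ : H ≠ 0 := by linarith
  field_simp
  ring
end

section
/- Let H be a real number with 1/2 < H < 1 and set c_H = Γ(2H+1)·sin(πH)/(2π). For all Schwartz functions φ, ψ : ℝ → ℂ, writing 𝓕φ(ξ) = ∫_ℝ e^{−iξy} φ(y) dy for the Fourier transform with kernel e^{−iξy}, one has c_H · ∫_ℝ 𝓕φ(ξ) · conj(𝓕ψ(ξ)) · |ξ|^{1−2H} dξ = H·(2H−1) · ∫_ℝ ∫_ℝ φ(y) · conj(ψ(y')) · |y−y'|^{2H−2} dy' dy, both sides being finite. -/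
open MeasureTheory Complex

/-- Fubini for a weight that is a superposition of nonnegative kernels. -/
lemma integral_mul_eq_integral_integral_kernel {X : Type*} [MeasurableSpace X] {μ : Measure X}
    [SFinite μ] {f : X → ℂ} {w : X → ℝ} {k : X → ℝ → ℝ} (hf : AEStronglyMeasurable f μ)
    (hk : Measurable (Function.uncurry k)) (hk0 : ∀ x, ∀ t ∈ Set.Ioi (0 : ℝ), 0 ≤ k x t)
    (hki : ∀ᵐ x ∂μ, IntegrableOn (k x) (Set.Ioi 0))
    (hkw : ∀ᵐ x ∂μ, ∫ t in Set.Ioi 0, k x t = w x)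
    (hfw : Integrable (fun x => f x * (w x : ℂ)) μ) :
    ∫ x, f x * (w x : ℂ) ∂μ = ∫ t in Set.Ioi 0, ∫ x, f x * (k x t : ℂ) ∂μ := by
  have hint : Integrable (Function.uncurry fun x t => f x * (k x t : ℂ))
      (μ.prod (volume.restrict (Set.Ioi 0))) := by
    refine (integrable_prod_iff ?_).2 ⟨?_, ?_⟩
    · exact hf.comp_fst.mul (measurable_ofReal.comp hk).aestronglyMeasurable
    · filter_upwards [hki] with x hx
      exact (Integrable.ofReal hx).const_mul (f x)
    · refine hfw.norm.congr ?_
      filter_upwards [hkw] with x hx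
      have h : ∀ t ∈ Set.Ioi (0 : ℝ), ‖f x * (k x t : ℂ)‖ = ‖f x‖ * k x t := fun t ht => by
        rw [norm_mul, norm_real, Real.norm_of_nonneg (hk0 x t ht)]
      have hw : 0 ≤ w x := hx ▸ setIntegral_nonneg measurableSet_Ioi (hk0 x)
      simp only [Function.uncurry]
      rw [setIntegral_congr_fun measurableSet_Ioi h, integral_const_mul, hx, norm_mul, norm_real,
        Real.norm_of_nonneg hw]
  rw [← integral_integral_swap hint]
  refine integral_congr_ae ?_
  filter_upwards [hkw] with x hx
  rw [integral_const_mul, integral_complex_ofReal, hx]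

/-- Gaussian superposition giving `|x| ^ (-s)`. -/
lemma integral_rpow_mul_exp_neg_mul_sq_Ioi {s x : ℝ} (hs : 0 < s) (hx : x ≠ 0) :
    ∫ t in Set.Ioi 0, t ^ (s / 2 - 1) * Real.exp (-(x ^ 2 * t)) =
      Real.Gamma (s / 2) * |x| ^ (-s) := by
  rw [Real.integral_rpow_mul_exp_neg_mul_Ioi (by positivity) (by positivity), mul_comm]
  congr 1
  rw [← sq_abs, one_div, ← Real.rpow_natCast, ← Real.rpow_neg (abs_nonneg x),
    ← Real.rpow_mul (abs_nonneg x)]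
  congr 1
  push_cast
  ring

/-- Heat-kernel superposition giving `|x| ^ (s - 1)`. -/
lemma integral_rpow_mul_exp_neg_sq_div_Ioi {s x : ℝ} (hs : s < 1) (hx : x ≠ 0) :
    ∫ t in Set.Ioi 0, t ^ (s / 2 - 3 / 2) * Real.exp (-(x ^ 2 / (4 * t))) =
      Real.Gamma ((1 - s) / 2) * 2 ^ (1 - s) * |x| ^ (s - 1) := by
  have h := Real.integral_rpow_mul_exp_neg_mul_Ioi (a := (1 - s) / 2) (r := (x / 2) ^ 2)
    (by linarith) (by positivity)
  rw [← integral_comp_rpow_Ioi _ (p := -1) (by norm_num)] at h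
  have hpow : (1 / (x / 2) ^ 2) ^ ((1 - s) / 2) = 2 ^ (1 - s) * |x| ^ (s - 1) := by
    have : 1 / (x / 2) ^ 2 = (2 / |x|) ^ (2 : ℝ) := by
      rw [Real.rpow_two, div_pow, div_pow, sq_abs, one_div_div]
    rw [this, ← Real.rpow_mul (by positivity), mul_div_cancel₀ _ two_ne_zero,
      Real.div_rpow (by norm_num) (abs_nonneg x), show s - 1 = -(1 - s) by ring,
      Real.rpow_neg (abs_nonneg x)]
    rfl
  rw [hpow] at h
  rw [mul_assoc, mul_comm, ← h]
  refine setIntegral_congr_fun measurableSet_Ioi fun t (ht : 0 < t) => ?_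
  simp only [smul_eq_mul, abs_neg, abs_one, one_mul]
  rw [← mul_assoc, ← Real.rpow_mul ht.le, ← Real.rpow_add ht, Real.rpow_neg_one]
  congr 2
  · ring
  · field_simp
    ring

lemma exists_integrable_abs_rpow_le_add_one {a : ℝ} (ha : -1 < a) (ha' : a < 0) :
    ∃ k : ℝ → ℝ, Integrable k ∧ (∀ x, 0 ≤ k x) ∧ ∀ x, |x| ^ a ≤ k x + 1 := by
  set g : ℝ → ℝ := Set.indicator (Set.Ioc 0 1) fun x => x ^ a with hg
  have hi : Integrable g := by
    have := intervalIntegral.intervalIntegrable_rpow' (a := 0) (b := 1) ha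
    rw [intervalIntegrable_iff_integrableOn_Ioc_of_le zero_le_one] at this
    exact this.integrable_indicator measurableSet_Ioc
  have h0 : ∀ x, 0 ≤ g x := fun x =>
    Set.indicator_nonneg (fun y hy => Real.rpow_nonneg hy.1.le a) x
  have hpos : ∀ x, 0 < x → x ^ a ≤ g x + 1 := fun x hx => by
    by_cases h : x ≤ 1
    · rw [hg, Set.indicator_of_mem (show x ∈ Set.Ioc (0 : ℝ) 1 from ⟨hx, h⟩)]
      linarith
    · have := Real.rpow_le_one_of_one_le_of_nonpos (not_le.1 h).le ha'.le
      linarith [h0 x]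
  refine ⟨fun x => g x + g (-x), hi.add hi.comp_neg, fun x => add_nonneg (h0 x) (h0 (-x)),
    fun x => ?_⟩
  have h1 := h0 x
  have h2 := h0 (-x)
  rcases lt_trichotomy x 0 with hx | rfl | hx
  · rw [abs_of_neg hx]
    linarith [hpos (-x) (by linarith)]
  · rw [abs_zero, Real.zero_rpow ha'.ne]
    positivity
  · rw [abs_of_pos hx]
    linarith [hpos x hx]

lemma integrable_mul_abs_sub_rpow {a : ℝ} (ha : -1 < a) (ha' : a < 0) {g : ℝ → ℂ} {B : ℝ}
    (hg : Integrable g) (hB : ∀ x, ‖g x‖ ≤ B) :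
    ∃ M, ∀ c, Integrable (fun x => g x * ((|c - x| ^ a : ℝ) : ℂ)) ∧
      ∫ x, ‖g x * ((|c - x| ^ a : ℝ) : ℂ)‖ ≤ M := by
  obtain ⟨k, hk, hk0, hle⟩ := exists_integrable_abs_rpow_le_add_one ha ha'
  refine ⟨B * (∫ x, k x) + ∫ x, ‖g x‖, fun c => ?_⟩
  have hbound : ∀ x, ‖g x * ((|c - x| ^ a : ℝ) : ℂ)‖ ≤ B * k (c - x) + ‖g x‖ := fun x => by
    rw [norm_mul, norm_real, Real.norm_of_nonneg (Real.rpow_nonneg (abs_nonneg _) a)]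
    calc ‖g x‖ * |c - x| ^ a ≤ ‖g x‖ * (k (c - x) + 1) := by gcongr; exact hle _
      _ = ‖g x‖ * k (c - x) + ‖g x‖ := by ring
      _ ≤ B * k (c - x) + ‖g x‖ := by gcongr; exacts [hk0 _, hB x]
  have hkc : Integrable fun x => B * k (c - x) := (hk.comp_sub_left c).const_mul B
  have hint : Integrable (fun x => g x * ((|c - x| ^ a : ℝ) : ℂ)) :=
    (hkc.add hg.norm).mono' (hg.aestronglyMeasurable.mul
      (by fun_prop : Measurable fun x : ℝ => ((|c - x| ^ a : ℝ) : ℂ)).aestronglyMeasurable)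
      (.of_forall hbound)
  refine ⟨hint, (integral_mono hint.norm (hkc.add hg.norm) hbound).trans_eq ?_⟩
  simp only [Pi.add_apply]
  rw [integral_add hkc hg.norm, integral_const_mul, integral_sub_left_eq_self k]

lemma integrable_prod_mul_abs_sub_rpow {a : ℝ} (ha : -1 < a) (ha' : a < 0) {f g : ℝ → ℂ} {B : ℝ}
    (hf : Integrable f) (hg : Integrable g) (hB : ∀ x, ‖g x‖ ≤ B) :
    Integrable (fun p : ℝ × ℝ => f p.1 * g p.2 * ((|p.1 - p.2| ^ a : ℝ) : ℂ))
      (volume.prod volume) := by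
  obtain ⟨M, hM⟩ := integrable_mul_abs_sub_rpow ha ha' hg hB
  have hmeas : AEStronglyMeasurable
      (fun p : ℝ × ℝ => f p.1 * g p.2 * ((|p.1 - p.2| ^ a : ℝ) : ℂ)) (volume.prod volume) :=
    (hf.aestronglyMeasurable.comp_fst.mul hg.aestronglyMeasurable.comp_snd).mul
      (by fun_prop : Measurable fun p : ℝ × ℝ =>
        ((|p.1 - p.2| ^ a : ℝ) : ℂ)).aestronglyMeasurable
  refine (integrable_prod_iff hmeas).2 ⟨.of_forall fun y => ?_, ?_⟩
  · simp only [mul_assoc]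
    exact (hM y).1.const_mul (f y)
  · refine (hf.norm.mul_const M).mono' hmeas.norm.integral_prod_right' (.of_forall fun y => ?_)
    rw [Real.norm_of_nonneg (integral_nonneg fun _ => norm_nonneg _)]
    simp only [mul_assoc, norm_mul (f _)]
    rw [integral_const_mul]
    exact mul_le_mul_of_nonneg_left (hM y).2 (norm_nonneg _)

lemma integral_exp_mul_conj_integral_exp (f g : ℝ → ℂ) (ξ : ℝ) :
    (∫ y : ℝ, cexp (-I * ξ * y) * f y) * (starRingEnd ℂ) (∫ y : ℝ, cexp (-I * ξ * y) * g y) =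
      ∫ p : ℝ × ℝ, f p.1 * (starRingEnd ℂ) (g p.2) * cexp (I * (p.2 - p.1 : ℝ) * ξ)
        ∂(volume.prod volume) := by
  rw [← integral_conj, ← integral_prod_mul]
  congr 1
  ext p
  rw [map_mul, ← exp_conj, mul_mul_mul_comm, ← exp_add, mul_comm]
  simp only [map_mul, map_neg, conj_I, conj_ofReal, ofReal_sub]
  ring_nf

/-- Parseval's identity regularized by a Gaussian in frequency. -/
lemma integral_fourier_mul_conj_fourier_mul_gaussian {f g : ℝ → ℂ} (hf : Integrable f)
    (hg : Integrable g) {t : ℝ} (ht : 0 < t) :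
    ∫ ξ : ℝ, (∫ y : ℝ, cexp (-I * ξ * y) * f y) *
        (starRingEnd ℂ) (∫ y : ℝ, cexp (-I * ξ * y) * g y) *
        ((Real.exp (-(ξ ^ 2 * t)) : ℝ) : ℂ) =
      ∫ p : ℝ × ℝ, f p.1 * (starRingEnd ℂ) (g p.2) *
        (((Real.pi / t) ^ (1 / 2 : ℝ) * Real.exp (-((p.1 - p.2) ^ 2 / (4 * t))) : ℝ) : ℂ)
        ∂(volume.prod volume) := by
  have hg' : Integrable fun y => (starRingEnd ℂ) (g y) :=
    hg.mono (continuous_conj.comp_aestronglyMeasurable hg.aestronglyMeasurable)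
      (.of_forall fun y => by simp)
  have hexp : Integrable fun ξ : ℝ => ((Real.exp (-(ξ ^ 2 * t)) : ℝ) : ℂ) := by
    refine Integrable.ofReal ((integrable_exp_neg_mul_sq ht).congr (.of_forall fun ξ => ?_))
    exact congrArg Real.exp (by ring)
  have hint : Integrable (Function.uncurry fun (ξ : ℝ) (p : ℝ × ℝ) =>
      f p.1 * (starRingEnd ℂ) (g p.2) * cexp (I * (p.2 - p.1 : ℝ) * ξ) *
        ((Real.exp (-(ξ ^ 2 * t)) : ℝ) : ℂ)) (volume.prod (volume.prod volume)) := by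
    have hc : Continuous fun q : ℝ × ℝ × ℝ => cexp (I * (q.2.2 - q.2.1 : ℝ) * q.1) := by fun_prop
    refine ((hexp.mul_prod (hf.mul_prod hg')).bdd_mul (c := 1) hc.aestronglyMeasurable
      (.of_forall fun q => ?_)).congr (.of_forall fun q => ?_)
    · rw [norm_exp]
      simp
    · simp only [Function.uncurry]
      ring
  simp only [integral_exp_mul_conj_integral_exp]
  simp only [← integral_mul_const]
  rw [integral_integral_swap hint]
  congr 1
  ext p
  simp only [mul_assoc, integral_const_mul]
  congr 2
  have h := fourierIntegral_gaussian (b := (t : ℂ)) (by simpa using ht) ((p.2 - p.1 : ℝ) : ℂ)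
  rw [ofReal_mul, ofReal_cpow (by positivity), ofReal_exp]
  convert h using 1
  · congr 1
    ext ξ
    push_cast
    ring_nf
  · push_cast
    ring_nf

lemma Gamma_two_mul_add_one_mul_sin {H : ℝ} (hH₁ : 1 / 2 < H) (hH₂ : H < 1) :
    Real.Gamma (2 * H + 1) * Real.sin (Real.pi * H) / (2 * Real.pi) *
        (√Real.pi * (Real.Gamma ((1 - (2 * H - 1)) / 2) * 2 ^ (1 - (2 * H - 1)))) =
      H * (2 * H - 1) * Real.Gamma ((2 * H - 1) / 2) := by
  have hdup := Real.Gamma_mul_Gamma_add_half ((2 * H - 1) / 2)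
  have hrefl := Real.Gamma_mul_Gamma_one_sub H
  have hsin : 0 < Real.sin (Real.pi * H) :=
    Real.sin_pos_of_pos_of_lt_pi (by positivity) (by nlinarith [Real.pi_pos])
  have hΓ : 0 < Real.Gamma H := Real.Gamma_pos_of_pos (by linarith)
  rw [show (2 * H - 1) / 2 + 1 / 2 = H by ring, show 2 * ((2 * H - 1) / 2) = 2 * H - 1 by ring]
    at hdup
  rw [show (1 - (2 * H - 1)) / 2 = 1 - H by ring, Real.Gamma_add_one (by linarith),
    show 2 * H = (2 * H - 1) + 1 by ring, Real.Gamma_add_one (by linarith)]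
  rw [show 2 * H - 1 + 1 - 1 = 2 * H - 1 by ring]
  rw [eq_div_iff hsin.ne'] at hrefl
  calc _ = H * (2 * H - 1) / Real.pi *
        (Real.Gamma (2 * H - 1) * 2 ^ (1 - (2 * H - 1)) * √Real.pi) *
        (Real.Gamma (1 - H) * Real.sin (Real.pi * H)) := by
          rw [show (2 * H - 1 + 1) = 2 * H by ring]; field_simp
    _ = H * (2 * H - 1) / Real.pi * Real.Gamma ((2 * H - 1) / 2) *
        (Real.Gamma H * Real.Gamma (1 - H) * Real.sin (Real.pi * H)) := by rw [← hdup]; ring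
    _ = _ := by rw [hrefl]; field_simp

open FourierTransform in
lemma SchwartzMap.integral_exp_mul_eq_fourier (φ : SchwartzMap ℝ ℂ) (ξ : ℝ) :
    ∫ y : ℝ, cexp (-I * ξ * y) * φ y = (𝓕 φ) (ξ / (2 * Real.pi)) := by
  rw [SchwartzMap.fourier_coe, Real.fourier_real_eq_integral_exp_smul]
  congr 1
  ext y
  rw [smul_eq_mul]
  congr 2
  have : (Real.pi : ℂ) ≠ 0 := by exact_mod_cast Real.pi_ne_zero
  push_cast
  field_simp

/-- Parseval-type identity equating the spectral form of the noise covariance,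
with spectral measure `μ(dξ) = c_H |ξ|^{1-2H} dξ`, to its Riesz-kernel form. -/
theorem spectral_riesz_parseval (H : ℝ) (hH₁ : 1/2 < H) (hH₂ : H < 1)
    (φ ψ : SchwartzMap ℝ ℂ) :
    Integrable (fun ξ : ℝ =>
        (∫ y : ℝ, Complex.exp (-Complex.I * ξ * y) * φ y) *
          (starRingEnd ℂ) (∫ y : ℝ, Complex.exp (-Complex.I * ξ * y) * ψ y) *
          ((|ξ| ^ (1 - 2*H) : ℝ) : ℂ)) ∧
    Integrable (fun p : ℝ × ℝ =>
        φ p.1 * (starRingEnd ℂ) (ψ p.2) * ((|p.1 - p.2| ^ (2*H - 2) : ℝ) : ℂ))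
      (volume.prod volume) ∧
    ((Real.Gamma (2*H + 1) * Real.sin (Real.pi * H) / (2 * Real.pi) : ℝ) : ℂ) *
        ∫ ξ : ℝ, (∫ y : ℝ, Complex.exp (-Complex.I * ξ * y) * φ y) *
          (starRingEnd ℂ) (∫ y : ℝ, Complex.exp (-Complex.I * ξ * y) * ψ y) *
          ((|ξ| ^ (1 - 2*H) : ℝ) : ℂ) =
      ((H * (2*H - 1) : ℝ) : ℂ) *
        ∫ y : ℝ, ∫ y' : ℝ,
          φ y * (starRingEnd ℂ) (ψ y') * ((|y - y'| ^ (2*H - 2) : ℝ) : ℂ) := by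
  have hs0 : 0 < 2 * H - 1 := by linarith
  have hs1 : 2 * H - 1 < 1 := by linarith
  have h2π : 2 * Real.pi ≠ 0 := by positivity
  set F : ℝ → ℂ := fun ξ => (∫ y : ℝ, cexp (-I * ξ * y) * φ y) *
    (starRingEnd ℂ) (∫ y : ℝ, cexp (-I * ξ * y) * ψ y)
  have hbound : ∀ ξ : ℝ, ‖∫ y : ℝ, cexp (-I * ξ * y) * φ y‖ ≤ _ := fun ξ =>
    (congrArg norm (φ.integral_exp_mul_eq_fourier ξ)).trans_le
      (SchwartzMap.norm_le_seminorm ℂ _ (ξ / (2 * Real.pi)))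
  have hbound' : ∀ ξ : ℝ, ‖(starRingEnd ℂ) (∫ y : ℝ, cexp (-I * ξ * y) * ψ y)‖ ≤ _ := fun ξ =>
    ((norm_conj _).trans (congrArg norm (ψ.integral_exp_mul_eq_fourier ξ))).trans_le
      (SchwartzMap.norm_le_seminorm ℂ _ (ξ / (2 * Real.pi)))
  have hφi : Integrable fun ξ : ℝ => ∫ y : ℝ, cexp (-I * ξ * y) * φ y := by
    simp only [SchwartzMap.integral_exp_mul_eq_fourier]
    exact (SchwartzMap.integrable _).comp_div h2π
  have hψc : Continuous fun ξ : ℝ => (starRingEnd ℂ) (∫ y : ℝ, cexp (-I * ξ * y) * ψ y) := by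
    simp only [SchwartzMap.integral_exp_mul_eq_fourier]
    exact continuous_conj.comp ((SchwartzMap.continuous _).comp (continuous_id.div_const _))
  have hFi : Integrable F := hφi.mul_bdd hψc.aestronglyMeasurable (.of_forall hbound')
  have hFb : ∀ ξ, ‖F ξ‖ ≤ _ := fun ξ => (norm_mul _ _).trans_le
    (mul_le_mul (hbound ξ) (hbound' ξ) (norm_nonneg _) ((norm_nonneg _).trans (hbound ξ)))
  have hspec : Integrable fun ξ : ℝ => F ξ * ((|ξ| ^ (1 - 2 * H) : ℝ) : ℂ) := by
    obtain ⟨M, hM⟩ := integrable_mul_abs_sub_rpow (a := 1 - 2 * H) (by linarith) (by linarith)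
      hFi hFb
    simpa only [zero_sub, abs_neg] using (hM 0).1
  have hψi : Integrable fun y => (starRingEnd ℂ) (ψ y) :=
    ψ.integrable.mono (continuous_conj.comp ψ.continuous).aestronglyMeasurable
      (.of_forall fun y => by simp)
  have hriesz := integrable_prod_mul_abs_sub_rpow (a := 2 * H - 2) (by linarith) (by linarith)
    φ.integrable hψi
    (fun y => (norm_conj (ψ y)).trans_le (SchwartzMap.norm_le_seminorm ℂ ψ y))
  refine ⟨hspec, hriesz, ?_⟩
  rw [← integral_prod _ hriesz]
  have hΓ : 0 < Real.Gamma ((2 * H - 1) / 2) := Real.Gamma_pos_of_pos (by linarith)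
  have hΓ' : 0 < Real.Gamma ((1 - (2 * H - 1)) / 2) := Real.Gamma_pos_of_pos (by linarith)
  have hleft : (Real.Gamma ((2 * H - 1) / 2) : ℂ) *
      ∫ ξ : ℝ, F ξ * ((|ξ| ^ (1 - 2 * H) : ℝ) : ℂ) =
      ∫ t in Set.Ioi 0, ∫ ξ : ℝ, F ξ *
        ((t ^ ((2 * H - 1) / 2 - 1) * Real.exp (-(ξ ^ 2 * t)) : ℝ) : ℂ) := by
    have hne : ∀ᵐ ξ : ℝ, ξ ≠ 0 := Measure.ae_ne volume 0
    rw [← integral_const_mul]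
    have hw : ∀ ξ : ℝ, (Real.Gamma ((2 * H - 1) / 2) : ℂ) *
        (F ξ * ((|ξ| ^ (1 - 2 * H) : ℝ) : ℂ)) =
        F ξ * ((Real.Gamma ((2 * H - 1) / 2) * |ξ| ^ (-(2 * H - 1)) : ℝ) : ℂ) := fun ξ => by
      rw [neg_sub, ofReal_mul]
      ring
    simp only [hw]
    refine integral_mul_eq_integral_integral_kernel hFi.aestronglyMeasurable
      (by unfold Function.uncurry; fun_prop) (fun ξ t (ht : 0 < t) => by positivity) ?_ ?_ ?_
    · filter_upwards [hne] with ξ hξ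
      refine Integrable.of_integral_ne_zero ?_
      rw [integral_rpow_mul_exp_neg_mul_sq_Ioi hs0 hξ]
      positivity
    · filter_upwards [hne] with ξ hξ
      exact integral_rpow_mul_exp_neg_mul_sq_Ioi hs0 hξ
    · simp only [← hw]
      exact hspec.const_mul _
  have hright :
      ((√Real.pi * (Real.Gamma ((1 - (2 * H - 1)) / 2) * 2 ^ (1 - (2 * H - 1))) : ℝ) : ℂ) *
      ∫ p : ℝ × ℝ, φ p.1 * (starRingEnd ℂ) (ψ p.2) * ((|p.1 - p.2| ^ (2 * H - 2) : ℝ) : ℂ)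
        ∂(volume.prod volume) =
      ∫ t in Set.Ioi 0, ∫ p : ℝ × ℝ, φ p.1 * (starRingEnd ℂ) (ψ p.2) *
        ((√Real.pi * (t ^ ((2 * H - 1) / 2 - 3 / 2) *
          Real.exp (-((p.1 - p.2) ^ 2 / (4 * t)))) : ℝ) : ℂ) ∂(volume.prod volume) := by
    have hne : ∀ᵐ p : ℝ × ℝ ∂(volume.prod volume), p.1 - p.2 ≠ 0 := by
      have hms : MeasurableSet {p : ℝ × ℝ | p.1 - p.2 ≠ 0} :=
        (isOpen_ne_fun (by fun_prop) continuous_const).measurableSet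
      refine (Measure.ae_prod_mem_iff_ae_ae_mem hms).2 (.of_forall fun y => ?_)
      filter_upwards [Measure.ae_ne volume y] with y' hy'
      exact sub_ne_zero.2 hy'.symm
    rw [← integral_const_mul]
    have hw : ∀ p : ℝ × ℝ,
        ((√Real.pi * (Real.Gamma ((1 - (2 * H - 1)) / 2) * 2 ^ (1 - (2 * H - 1))) : ℝ) : ℂ) *
        (φ p.1 * (starRingEnd ℂ) (ψ p.2) * ((|p.1 - p.2| ^ (2 * H - 2) : ℝ) : ℂ)) =
        φ p.1 * (starRingEnd ℂ) (ψ p.2) * ((√Real.pi * (Real.Gamma ((1 - (2 * H - 1)) / 2) *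
          2 ^ (1 - (2 * H - 1)) * |p.1 - p.2| ^ (2 * H - 1 - 1)) : ℝ) : ℂ) := fun p => by
      rw [show 2 * H - 1 - 1 = 2 * H - 2 by ring]
      simp only [ofReal_mul]
      ring
    simp only [hw]
    refine integral_mul_eq_integral_integral_kernel
      (φ.integrable.mul_prod hψi).aestronglyMeasurable
      (by unfold Function.uncurry; fun_prop) (fun p t (ht : 0 < t) => by positivity) ?_ ?_ ?_
    · filter_upwards [hne] with p hp
      refine (Integrable.of_integral_ne_zero ?_).const_mul _
      rw [integral_rpow_mul_exp_neg_sq_div_Ioi hs1 hp]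
      positivity
    · filter_upwards [hne] with p hp
      rw [integral_const_mul, integral_rpow_mul_exp_neg_sq_div_Ioi hs1 hp]
    · simp only [← hw]
      exact hriesz.const_mul _
  have hmid : (Real.Gamma ((2 * H - 1) / 2) : ℂ) *
      ∫ ξ : ℝ, F ξ * ((|ξ| ^ (1 - 2 * H) : ℝ) : ℂ) =
      ((√Real.pi * (Real.Gamma ((1 - (2 * H - 1)) / 2) * 2 ^ (1 - (2 * H - 1))) : ℝ) : ℂ) *
      ∫ p : ℝ × ℝ, φ p.1 * (starRingEnd ℂ) (ψ p.2) * ((|p.1 - p.2| ^ (2 * H - 2) : ℝ) : ℂ)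
        ∂(volume.prod volume) := by
    rw [hleft, hright]
    refine setIntegral_congr_fun measurableSet_Ioi fun t (ht : 0 < t) => ?_
    have h := congrArg (fun z : ℂ => ((t ^ ((2 * H - 1) / 2 - 1) : ℝ) : ℂ) * z)
      (integral_fourier_mul_conj_fourier_mul_gaussian φ.integrable ψ.integrable ht)
    simp only [← integral_const_mul] at h
    convert h using 1
    · congr 1
      ext ξ
      rw [ofReal_mul]
      ring
    · congr 1
      ext p
      have hpow : √Real.pi * t ^ ((2 * H - 1) / 2 - 3 / 2) =
          t ^ ((2 * H - 1) / 2 - 1) * (Real.pi / t) ^ (1 / 2 : ℝ) := by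
        rw [Real.div_rpow Real.pi_pos.le ht.le, ← Real.sqrt_eq_rpow Real.pi, mul_div_left_comm,
          ← Real.rpow_sub ht]
        ring_nf
      rw [← mul_assoc √Real.pi, hpow]
      push_cast
      ring
  have hconst := congrArg (fun x : ℝ => (x : ℂ)) (Gamma_two_mul_add_one_mul_sin hH₁ hH₂)
  simp only [ofReal_mul (_ / _), ofReal_mul (H * _)] at hconst
  refine mul_left_cancel₀ (ofReal_ne_zero.2 hΓ.ne') ?_
  rw [mul_left_comm, hmid, ← mul_assoc, hconst]
  ring
end

section
/- Let H be a real number with 1/2 < H < 1, let τ, λ ∈ ℝ and ε > 0, and set s₀ = (τ+λ)/√2 and m = (λ−τ)/√2. Then ∫_{s₀}^{s₀+ε/√2} ( ∫_{√2·λ − s}^{m} ∫_{√2·λ − s}^{m} |y−ỹ|^{2H−2} · (s − y − √2·τ)^H · (s − ỹ − √2·τ)^H dỹ dy ) ds ≤ ε^{4H+1} / ( √2 · (4H+1) · H · (2H−1) ). -/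
open MeasureTheory

/-- Monotonicity of the interval integral for a nonnegative integrand: no integrability of the
smaller function is needed. -/
lemma intervalIntegral_mono_of_nonneg {f g : ℝ → ℝ} {a b : ℝ} (hab : a ≤ b)
    (hf : ∀ x ∈ Set.Ioc a b, 0 ≤ f x) (hfg : ∀ x ∈ Set.Ioc a b, f x ≤ g x)
    (hg : IntervalIntegrable g volume a b) :
    ∫ x in a..b, f x ≤ ∫ x in a..b, g x := by
  rw [intervalIntegral.integral_of_le hab, intervalIntegral.integral_of_le hab]
  exact integral_mono_of_nonneg
    ((ae_restrict_iff' measurableSet_Ioc).2 (Filter.Eventually.of_forall hf)) hg.1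
    ((ae_restrict_iff' measurableSet_Ioc).2 (Filter.Eventually.of_forall hfg))

lemma intervalIntegrable_const_sub_rpow {p : ℝ} (hp : -1 < p) (a b c : ℝ) :
    IntervalIntegrable (fun x : ℝ => (c - x) ^ p) volume a b := by
  simpa using (intervalIntegral.intervalIntegrable_rpow' hp (a := c - a) (b := c - b)).comp_sub_left c

lemma intervalIntegrable_sub_const_rpow {p : ℝ} (hp : -1 < p) (a b c : ℝ) :
    IntervalIntegrable (fun x : ℝ => (x - c) ^ p) volume a b := by
  simpa using
    (intervalIntegral.intervalIntegrable_rpow' hp (a := a - c) (b := b - c)).comp_sub_right c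

lemma integral_const_sub_rpow {p : ℝ} (hp : -1 < p) (a b : ℝ) :
    ∫ x in a..b, (b - x) ^ p = (b - a) ^ (p + 1) / (p + 1) := by
  rw [intervalIntegral.integral_comp_sub_left (fun x : ℝ => x ^ p), integral_rpow (Or.inl hp),
    sub_self, Real.zero_rpow (by linarith), sub_zero]

lemma integral_sub_const_rpow {p : ℝ} (hp : -1 < p) (a b : ℝ) :
    ∫ x in a..b, (x - a) ^ p = (b - a) ^ (p + 1) / (p + 1) := by
  rw [intervalIntegral.integral_comp_sub_right (fun x : ℝ => x ^ p), integral_rpow (Or.inl hp),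
    sub_self, Real.zero_rpow (by linarith), sub_zero]

lemma abs_sub_rpow_eqOn_left {a y : ℝ} (p : ℝ) (hay : a ≤ y) :
    Set.EqOn (fun z : ℝ => (y - z) ^ p) (fun z : ℝ => |y - z| ^ p) (Set.uIcc a y) := by
  intro z hz
  rw [Set.uIcc_of_le hay] at hz
  simp only [abs_of_nonneg (sub_nonneg.2 hz.2)]

lemma abs_sub_rpow_eqOn_right {y b : ℝ} (p : ℝ) (hyb : y ≤ b) :
    Set.EqOn (fun z : ℝ => (z - y) ^ p) (fun z : ℝ => |y - z| ^ p) (Set.uIcc y b) := by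
  intro z hz
  rw [Set.uIcc_of_le hyb] at hz
  simp only [abs_sub_comm y z, abs_of_nonneg (sub_nonneg.2 hz.1)]

lemma intervalIntegrable_abs_sub_rpow_left {p : ℝ} (hp : -1 < p) {a y : ℝ} (hay : a ≤ y) :
    IntervalIntegrable (fun z : ℝ => |y - z| ^ p) volume a y :=
  (intervalIntegrable_const_sub_rpow hp a y y).congr
    ((abs_sub_rpow_eqOn_left p hay).mono Set.uIoc_subset_uIcc)

lemma intervalIntegrable_abs_sub_rpow_right {p : ℝ} (hp : -1 < p) {y b : ℝ} (hyb : y ≤ b) :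
    IntervalIntegrable (fun z : ℝ => |y - z| ^ p) volume y b :=
  (intervalIntegrable_sub_const_rpow hp y b y).congr
    ((abs_sub_rpow_eqOn_right p hyb).mono Set.uIoc_subset_uIcc)

lemma integral_abs_sub_rpow_s11 {p : ℝ} (hp : -1 < p) {a y b : ℝ} (hay : a ≤ y) (hyb : y ≤ b) :
    ∫ z in a..b, |y - z| ^ p = ((y - a) ^ (p + 1) + (b - y) ^ (p + 1)) / (p + 1) := by
  rw [← intervalIntegral.integral_add_adjacent_intervals
      (intervalIntegrable_abs_sub_rpow_left hp hay) (intervalIntegrable_abs_sub_rpow_right hp hyb),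
    ← intervalIntegral.integral_congr (abs_sub_rpow_eqOn_left p hay),
    ← intervalIntegral.integral_congr (abs_sub_rpow_eqOn_right p hyb),
    integral_const_sub_rpow hp, integral_sub_const_rpow hp, add_div]

/-- The Riesz-type double integral over a square, with two weights bounded by `M`. -/
lemma integral_integral_abs_sub_rpow_mul_le {p a b M : ℝ} (hp : -1 < p) (hab : a ≤ b)
    {w : ℝ → ℝ} (hw : ∀ x ∈ Set.Ioc a b, 0 ≤ w x) (hwM : ∀ x ∈ Set.Ioc a b, w x ≤ M) :
    ∫ y in a..b, ∫ z in a..b, |y - z| ^ p * w y * w z ≤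
      M ^ 2 * (2 * (b - a) ^ (p + 2) / ((p + 1) * (p + 2))) := by
  have hp' : -1 < p + 1 := by linarith
  have hnn : ∀ y ∈ Set.Ioc a b, ∀ z ∈ Set.Ioc a b, 0 ≤ |y - z| ^ p * w y * w z :=
    fun y hy z hz =>
      mul_nonneg (mul_nonneg (Real.rpow_nonneg (abs_nonneg _) _) (hw y hy)) (hw z hz)
  have hI₁ := intervalIntegrable_sub_const_rpow hp' a b a
  have hI₂ := intervalIntegrable_const_sub_rpow hp' a b b
  calc ∫ y in a..b, ∫ z in a..b, |y - z| ^ p * w y * w z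
      ≤ ∫ y in a..b, M ^ 2 / (p + 1) * ((y - a) ^ (p + 1) + (b - y) ^ (p + 1)) := by
        refine intervalIntegral_mono_of_nonneg hab (fun y hy => ?_) (fun y hy => ?_)
          ((hI₁.add hI₂).const_mul _)
        · rw [intervalIntegral.integral_of_le hab]
          exact setIntegral_nonneg measurableSet_Ioc (hnn y hy)
        · calc ∫ z in a..b, |y - z| ^ p * w y * w z
              ≤ ∫ z in a..b, M ^ 2 * |y - z| ^ p := by
                refine intervalIntegral_mono_of_nonneg hab (hnn y hy) (fun z hz => ?_)
                  (((intervalIntegrable_abs_sub_rpow_left hp hy.1.le).trans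
                    (intervalIntegrable_abs_sub_rpow_right hp hy.2)).const_mul _)
                have hM : w y * w z ≤ M * M :=
                  mul_le_mul (hwM y hy) (hwM z hz) (hw z hz) ((hw y hy).trans (hwM y hy))
                have := mul_le_mul_of_nonneg_left hM (Real.rpow_nonneg (abs_nonneg (y - z)) p)
                linarith
            _ = _ := by
                rw [intervalIntegral.integral_const_mul, integral_abs_sub_rpow_s11 hp hy.1.le hy.2]
                ring
    _ = _ := by
        rw [intervalIntegral.integral_const_mul, intervalIntegral.integral_add hI₁ hI₂,
          integral_sub_const_rpow hp', integral_const_sub_rpow hp',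
          show p + 1 + 1 = p + 2 by ring]
        have h₁ : p + 1 ≠ 0 := by linarith
        have h₂ : p + 2 ≠ 0 := by linarith
        field_simp
        ring

/-- Bound for the first of the four terms in the estimate of `I₁` in the proof of
the local linearization theorem. -/
theorem I1_first_term_bound (H τ lam ε : ℝ) (hH₁ : 1/2 < H) (hH₂ : H < 1) (hε : 0 < ε) :
    (∫ s in ((τ + lam)/Real.sqrt 2)..((τ + lam)/Real.sqrt 2 + ε/Real.sqrt 2),
      ∫ y in (Real.sqrt 2 * lam - s)..((lam - τ)/Real.sqrt 2),
        ∫ z in (Real.sqrt 2 * lam - s)..((lam - τ)/Real.sqrt 2),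
          |y - z| ^ (2*H - 2) * (s - y - Real.sqrt 2 * τ) ^ H *
            (s - z - Real.sqrt 2 * τ) ^ H) ≤
      ε ^ (4*H + 1) / (Real.sqrt 2 * (4*H + 1) * H * (2*H - 1)) := by
  have hq : 0 < Real.sqrt 2 := by positivity
  have hqq : Real.sqrt 2 * Real.sqrt 2 = 2 := Real.mul_self_sqrt (by norm_num)
  have half : ∀ x : ℝ, x / Real.sqrt 2 = Real.sqrt 2 * x / 2 := fun x => by
    rw [div_eq_div_iff hq.ne' two_ne_zero]
    linear_combination -x * hqq
  have hs₀ : (τ + lam) / Real.sqrt 2 = Real.sqrt 2 * τ / 2 + Real.sqrt 2 * lam / 2 := by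
    rw [half]; ring
  have hm : (lam - τ) / Real.sqrt 2 = Real.sqrt 2 * lam / 2 - Real.sqrt 2 * τ / 2 := by
    rw [half]; ring
  have hδ : 0 < ε / Real.sqrt 2 := by positivity
  set s₀ := (τ + lam) / Real.sqrt 2
  set m := (lam - τ) / Real.sqrt 2
  have h4 : -1 < 4 * H := by linarith
  have hH0 : 0 < 2 * H - 1 := by linarith
  have weight : ∀ s ∈ Set.Ioc s₀ (s₀ + ε / Real.sqrt 2),
      ∀ x ∈ Set.Ioc (Real.sqrt 2 * lam - s) m,
      0 ≤ s - x - Real.sqrt 2 * τ ∧ s - x - Real.sqrt 2 * τ ≤ 2 * (s - s₀) := by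
    rintro s ⟨hs, -⟩ x ⟨hx₁, hx₂⟩
    constructor <;> linarith
  calc _ ≤ ∫ s in s₀..(s₀ + ε / Real.sqrt 2),
          2 ^ (2 * H) / (H * (2 * H - 1)) * (s - s₀) ^ (4 * H) := by
        refine intervalIntegral_mono_of_nonneg (by linarith) (fun s hs => ?_) (fun s hs => ?_)
          ((intervalIntegrable_sub_const_rpow h4 _ _ _).const_mul _)
        · have hab : Real.sqrt 2 * lam - s ≤ m := by linarith [hs.1]
          rw [intervalIntegral.integral_of_le hab]
          refine setIntegral_nonneg measurableSet_Ioc fun y hy => ?_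
          rw [intervalIntegral.integral_of_le hab]
          exact setIntegral_nonneg measurableSet_Ioc fun z hz =>
            mul_nonneg (mul_nonneg (Real.rpow_nonneg (abs_nonneg _) _)
              (Real.rpow_nonneg (weight s hs y hy).1 _)) (Real.rpow_nonneg (weight s hs z hz).1 _)
        · have hr : 0 < s - s₀ := sub_pos.2 hs.1
          refine (integral_integral_abs_sub_rpow_mul_le (p := 2 * H - 2)
            (w := fun x => (s - x - Real.sqrt 2 * τ) ^ H) (M := (2 * (s - s₀)) ^ H)
            (by linarith) (by linarith)
            (fun x hx => Real.rpow_nonneg (weight s hs x hx).1 _)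
            (fun x hx => Real.rpow_le_rpow (weight s hs x hx).1 (weight s hs x hx).2
              (by linarith))).trans_eq ?_
          rw [show m - (Real.sqrt 2 * lam - s) = s - s₀ by linarith,
            show 2 * H - 2 + 2 = 2 * H by ring, show 2 * H - 2 + 1 = 2 * H - 1 by ring,
            ← Real.rpow_mul_natCast (by positivity), Real.mul_rpow zero_le_two hr.le,
            show 4 * H = 2 * H + 2 * H by ring, Real.rpow_add hr,
            show H * ((2 : ℕ) : ℝ) = 2 * H by push_cast; ring]
          field_simp
    _ = _ := by
        rw [intervalIntegral.integral_const_mul, integral_sub_const_rpow h4, add_sub_cancel_left,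
          Real.div_rpow hε.le hq.le, Real.rpow_add_one hq.ne',
          show 4 * H = ((2 : ℕ) : ℝ) * (2 * H) by push_cast; ring,
          Real.rpow_mul hq.le, Real.rpow_natCast, Real.sq_sqrt zero_le_two]
        have : (2 : ℝ) ^ (2 * H) ≠ 0 := by positivity
        field_simp
end

section
/- Let H be a real number with 1/2 < H < 1, let τ, λ ∈ ℝ and ε > 0, and set s₀ = (τ+λ)/√2 and m = (λ−τ)/√2. Then ∫_{s₀}^{s₀+ε/√2} ( ∫_{√2·λ − s}^{m} ∫_{m}^{s − √2·τ} |y−ỹ|^{2H−2} · (s − y − √2·τ)^H · (s + ỹ − √2·λ)^H dỹ dy ) ds ≤ (2^{2H−1} − 1) · ε^{4H+1} / ( √2 · (4H+1) · H · (2H−1) ). -/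
open MeasureTheory

open Set in
/-- Monotonicity of the interval integral for a nonnegative, not necessarily measurable,
integrand dominated by an integrable one. -/
lemma intervalIntegral_le_of_nonneg_of_le_Ioo {f g : ℝ → ℝ} {a b : ℝ} (hab : a ≤ b)
    (hg : IntervalIntegrable g volume a b) (hf : ∀ x ∈ Ioo a b, 0 ≤ f x)
    (hfg : ∀ x ∈ Ioo a b, f x ≤ g x) : ∫ x in a..b, f x ≤ ∫ x in a..b, g x := by
  rw [intervalIntegral.integral_of_le hab, intervalIntegral.integral_of_le hab,
    integral_Ioc_eq_integral_Ioo, integral_Ioc_eq_integral_Ioo]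
  rw [intervalIntegrable_iff_integrableOn_Ioo_of_le hab] at hg
  exact integral_mono_of_nonneg ((ae_restrict_iff' measurableSet_Ioo).2 (.of_forall hf)) hg
    ((ae_restrict_iff' measurableSet_Ioo).2 (.of_forall hfg))

open Set in
lemma intervalIntegral_nonneg_of_nonneg_Ioo {f : ℝ → ℝ} {a b : ℝ} (hab : a ≤ b)
    (hf : ∀ x ∈ Ioo a b, 0 ≤ f x) : 0 ≤ ∫ x in a..b, f x := by
  rw [intervalIntegral.integral_of_le hab, integral_Ioc_eq_integral_Ioo]
  exact setIntegral_nonneg measurableSet_Ioo hf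

lemma intervalIntegrable_sub_rpow {y a b r : ℝ} (hya : y < a) (hab : a ≤ b) :
    IntervalIntegrable (fun z : ℝ => (z - y) ^ r) volume a b := by
  refine ContinuousOn.intervalIntegrable fun z hz => ?_
  rw [Set.uIcc_of_le hab] at hz
  refine ContinuousAt.continuousWithinAt (ContinuousAt.rpow_const (by fun_prop) (Or.inl ?_))
  linarith [hz.1]

lemma integral_sub_rpow {y a b r : ℝ} (hya : y < a) (hab : a ≤ b) (hr : r ≠ -1) :
    ∫ z in a..b, (z - y) ^ r = ((b - y) ^ (r + 1) - (a - y) ^ (r + 1)) / (r + 1) := by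
  rw [intervalIntegral.integral_comp_sub_right (fun x : ℝ => x ^ r), integral_rpow]
  refine Or.inr ⟨hr, fun h => ?_⟩
  rw [Set.uIcc_of_le (by linarith)] at h
  linarith [h.1]

/-- The Riesz kernel `|y - z| ^ (2 * H - 2)` integrated over the two halves of
`[m - u, m + u]`, after the inner integration. -/
lemma integral_riesz_halves {H m u : ℝ} (hH : 1 / 2 < H) (hu : 0 ≤ u) :
    ∫ y in (m - u)..m, ((m + u - y) ^ (2 * H - 1) - (m - y) ^ (2 * H - 1)) / (2 * H - 1) =
      ((2 : ℝ) ^ (2 * H - 1) - 1) / (H * (2 * H - 1)) * u ^ (2 * H) := by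
  have hr : 0 ≤ 2 * H - 1 := by linarith
  have hcont : ∀ c : ℝ, Continuous fun y : ℝ => (c - y) ^ (2 * H - 1) := fun c =>
    Continuous.rpow_const (by fun_prop) fun _ => Or.inr hr
  rw [intervalIntegral.integral_div, intervalIntegral.integral_sub
    ((hcont _).intervalIntegrable _ _) ((hcont _).intervalIntegrable _ _),
    intervalIntegral.integral_comp_sub_left (fun x : ℝ => x ^ (2 * H - 1)),
    intervalIntegral.integral_comp_sub_left (fun x : ℝ => x ^ (2 * H - 1)),
    integral_rpow (Or.inl (by linarith)), integral_rpow (Or.inl (by linarith))]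
  have h2 : (2 : ℝ) ^ (2 * H) = 2 * 2 ^ (2 * H - 1) := by
    rw [Real.rpow_sub_one two_ne_zero]; ring
  have e1 : m + u - m = u := by ring
  have e2 : m + u - (m - u) = 2 * u := by ring
  have e3 : m - (m - u) = u := by ring
  have e4 : 2 * H - 1 + 1 = 2 * H := by ring
  rw [e1, e2, e3, e4, sub_self, Real.zero_rpow (by linarith),
    Real.mul_rpow zero_le_two hu, h2]
  have : 2 * H - 1 ≠ 0 := by linarith
  have : H ≠ 0 := by linarith
  field_simp
  ring

/-- Pointwise bound of the weighted Riesz kernel on the two halves of `[m - u, m + u]`. -/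
lemma weighted_riesz_le {H m u y z : ℝ} (hH : 0 ≤ H) (hu : 0 ≤ u)
    (hy : y ∈ Set.Ioo (m - u) m) (hz : z ∈ Set.Ioo m (m + u)) :
    |y - z| ^ (2 * H - 2) * (u + m - y) ^ H * (u + z - m) ^ H ≤
      (2 * u) ^ (2 * H) * (z - y) ^ (2 * H - 2) := by
  obtain ⟨hy₁, hy₂⟩ := hy
  obtain ⟨hz₁, hz₂⟩ := hz
  rw [abs_sub_comm, abs_of_pos (by linarith : 0 < z - y)]
  have hk : 0 ≤ (z - y) ^ (2 * H - 2) := Real.rpow_nonneg (by linarith) _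
  have h₁ : (u + m - y) ^ H ≤ (2 * u) ^ H :=
    Real.rpow_le_rpow (by linarith) (by linarith) hH
  have h₂ : (u + z - m) ^ H ≤ (2 * u) ^ H :=
    Real.rpow_le_rpow (by linarith) (by linarith) hH
  have h₃ : 0 ≤ (u + z - m) ^ H := Real.rpow_nonneg (by linarith) _
  have h₄ : 0 ≤ (2 * u) ^ H := Real.rpow_nonneg (by linarith) _
  have h₅ : (2 * u) ^ (2 * H) = (2 * u) ^ H * (2 * u) ^ H := by
    rw [two_mul H, Real.rpow_add_of_nonneg (by linarith) hH hH]
  calc _ = (z - y) ^ (2 * H - 2) * ((u + m - y) ^ H * (u + z - m) ^ H) := by ring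
    _ ≤ (z - y) ^ (2 * H - 2) * ((2 * u) ^ H * (2 * u) ^ H) := by gcongr
    _ = _ := by rw [h₅]; ring

lemma weighted_riesz_nonneg {H m u y z : ℝ}
    (hy : y ∈ Set.Ioo (m - u) m) (hz : z ∈ Set.Ioo m (m + u)) :
    0 ≤ |y - z| ^ (2 * H - 2) * (u + m - y) ^ H * (u + z - m) ^ H := by
  obtain ⟨hy₁, hy₂⟩ := hy
  obtain ⟨hz₁, hz₂⟩ := hz
  exact mul_nonneg (mul_nonneg (Real.rpow_nonneg (abs_nonneg _) _)
    (Real.rpow_nonneg (by linarith) _)) (Real.rpow_nonneg (by linarith) _)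

lemma integral_weighted_riesz_nonneg {H m u : ℝ} (hu : 0 ≤ u) :
    0 ≤ ∫ y in (m - u)..m, ∫ z in m..(m + u),
      |y - z| ^ (2 * H - 2) * (u + m - y) ^ H * (u + z - m) ^ H :=
  intervalIntegral_nonneg_of_nonneg_Ioo (by linarith) fun _ hy =>
    intervalIntegral_nonneg_of_nonneg_Ioo (by linarith) fun _ hz => weighted_riesz_nonneg hy hz

lemma integral_weighted_riesz_le {H m u : ℝ} (hH : 1 / 2 < H) (hu : 0 ≤ u) :
    ∫ y in (m - u)..m, ∫ z in m..(m + u),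
      |y - z| ^ (2 * H - 2) * (u + m - y) ^ H * (u + z - m) ^ H ≤
      (2 : ℝ) ^ (2 * H) * (((2 : ℝ) ^ (2 * H - 1) - 1) / (H * (2 * H - 1))) * u ^ (4 * H) := by
  have hr : 0 ≤ 2 * H - 1 := by linarith
  have hcont : ∀ c : ℝ, Continuous fun y : ℝ => (c - y) ^ (2 * H - 1) := fun c =>
    Continuous.rpow_const (by fun_prop) fun _ => Or.inr hr
  calc _ ≤ ∫ y in (m - u)..m, (2 * u) ^ (2 * H) *
        (((m + u - y) ^ (2 * H - 1) - (m - y) ^ (2 * H - 1)) / (2 * H - 1)) := by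
        refine intervalIntegral_le_of_nonneg_of_le_Ioo (by linarith) ?_
          (fun _ hy => intervalIntegral_nonneg_of_nonneg_Ioo (by linarith)
            fun _ hz => weighted_riesz_nonneg hy hz) fun y hy => ?_
        · exact ((((hcont _).sub (hcont _)).div_const _).const_mul _).intervalIntegrable _ _
        · have hint := integral_sub_rpow (r := 2 * H - 2) hy.2 (by linarith : m ≤ m + u)
            (by linarith)
          rw [show 2 * H - 2 + 1 = 2 * H - 1 by ring] at hint
          rw [← hint, ← intervalIntegral.integral_const_mul]
          exact intervalIntegral_le_of_nonneg_of_le_Ioo (by linarith)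
            ((intervalIntegrable_sub_rpow hy.2 (by linarith)).const_mul _)
            (fun _ hz => weighted_riesz_nonneg hy hz)
            fun _ hz => weighted_riesz_le (by linarith) hu hy hz
    _ = _ := by
        rw [intervalIntegral.integral_const_mul, integral_riesz_halves hH hu,
          Real.mul_rpow zero_le_two hu, show 4 * H = 2 * H + 2 * H by ring,
          Real.rpow_add_of_nonneg hu (by linarith) (by linarith)]
        ring

/-- Bound for the second (mixed) term in the estimate of `I₁` in the proof of the
local linearization theorem. -/
theorem I1_mixed_term_bound (H τ lam ε : ℝ) (hH₁ : 1/2 < H) (hH₂ : H < 1) (hε : 0 < ε) :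
    (∫ s in ((τ + lam)/Real.sqrt 2)..((τ + lam)/Real.sqrt 2 + ε/Real.sqrt 2),
      ∫ y in (Real.sqrt 2 * lam - s)..((lam - τ)/Real.sqrt 2),
        ∫ z in ((lam - τ)/Real.sqrt 2)..(s - Real.sqrt 2 * τ),
          |y - z| ^ (2*H - 2) * (s - y - Real.sqrt 2 * τ) ^ H *
            (s + z - Real.sqrt 2 * lam) ^ H) ≤
      ((2 : ℝ) ^ (2*H - 1) - 1) * ε ^ (4*H + 1) /
        (Real.sqrt 2 * (4*H + 1) * H * (2*H - 1)) := by
  have h2 : 0 < Real.sqrt 2 := by positivity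
  have hsq : Real.sqrt 2 * Real.sqrt 2 = 2 := Real.mul_self_sqrt zero_le_two
  set s₀ := (τ + lam) / Real.sqrt 2 with hs₀
  set m := (lam - τ) / Real.sqrt 2 with hm
  set d := ε / Real.sqrt 2 with hd
  have hd0 : 0 < d := by positivity
  have hlam : Real.sqrt 2 * lam = s₀ + m := by
    rw [hs₀, hm]; field_simp; linear_combination lam * hsq
  have hτ : Real.sqrt 2 * τ = s₀ - m := by
    rw [hs₀, hm]; field_simp; linear_combination τ * hsq
  have hshift : ∀ s : ℝ,
      (∫ y in (Real.sqrt 2 * lam - s)..m, ∫ z in m..(s - Real.sqrt 2 * τ),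
        |y - z| ^ (2*H - 2) * (s - y - Real.sqrt 2 * τ) ^ H *
          (s + z - Real.sqrt 2 * lam) ^ H) =
      ∫ y in (m - (s - s₀))..m, ∫ z in m..(m + (s - s₀)),
        |y - z| ^ (2 * H - 2) * ((s - s₀) + m - y) ^ H * ((s - s₀) + z - m) ^ H := by
    intro s
    rw [hlam, hτ, show s₀ + m - s = m - (s - s₀) by ring,
      show s - (s₀ - m) = m + (s - s₀) by ring]
    simp only [show ∀ y, s - y - (s₀ - m) = s - s₀ + m - y from fun y => by ring,
      show ∀ z, s + z - (s₀ + m) = s - s₀ + z - m from fun z => by ring]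
  simp only [hshift]
  have hcont : Continuous fun s : ℝ => (s - s₀) ^ (4 * H) :=
    Continuous.rpow_const (by fun_prop) fun _ => Or.inr (by linarith)
  refine (intervalIntegral_le_of_nonneg_of_le_Ioo (by linarith)
    ((hcont.const_mul _).intervalIntegrable _ _)
    (fun s hs => integral_weighted_riesz_nonneg (by linarith [hs.1]))
    fun s hs => integral_weighted_riesz_le hH₁ (by linarith [hs.1])).trans_eq ?_
  rw [intervalIntegral.integral_const_mul,
    intervalIntegral.integral_comp_sub_right (fun x : ℝ => x ^ (4 * H)),
    integral_rpow (Or.inl (by linarith)), sub_self, add_sub_cancel_left,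
    Real.zero_rpow (by linarith), sub_zero, hd, Real.div_rpow hε.le h2.le]
  have hpow : Real.sqrt 2 ^ (4 * H + 1) = 2 ^ (2 * H) * Real.sqrt 2 := by
    rw [Real.rpow_add_one h2.ne', show 4 * H = 2 * (2 * H) by ring, Real.rpow_mul h2.le,
      Real.rpow_two, Real.sq_sqrt zero_le_two]
  have : (2 : ℝ) ^ (2 * H) ≠ 0 := by positivity
  have : 2 * H - 1 ≠ 0 := by linarith
  have : 4 * H + 1 ≠ 0 := by linarith
  have : H ≠ 0 := by linarith
  rw [hpow]
  field_simp
end
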